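/- arXiv:math/9601201 — 2 statements merged into one kernel-verified Lean document; each statement's English description precedes it below -/
import Mathlib

section
/- Let (W,S) be a Coxeter system, let X, X' ⊆ S and let w ∈ W. Write w = u_0 v u_0' where u_0 ∈ W_X, u_0' ∈ W_{X'}, and v is (X,X')-reduced. Then W_X ∩ (w W_{X'} w^{-1}) = u_0 W_Y u_0^{-1}, where Y = (v X' v^{-1}) ∩ X. -/
open scoped Pointwise

namespace CoxeterCommensurator

variable {B W : Type*} [Group W]

/-- The standard parabolic subgroup `W_X` of the Coxeter system `cs`, generated by the
simple reflections indexed by `X`. -/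
def parab {M : CoxeterMatrix B} (cs : CoxeterSystem M W) (X : Set B) : Subgroup W :=
  Subgroup.closure (cs.simple '' X)

section Exchange

variable {M : CoxeterMatrix B} (cs : CoxeterSystem M W)

open Classical in
/-- The action of a simple reflection on `W × ZMod 2` whose second component records
inversions modulo two. -/
noncomputable def reflectionAction (i : B) : Function.End (W × ZMod 2) :=
  fun p => (cs.simple i * p.1 * cs.simple i, p.2 + if p.1 = cs.simple i then 1 else 0)

open Classical in
theorem reflectionAction_mul_pow_apply (i j : B) (m : ℕ) (p : W × ZMod 2) :
    ((reflectionAction cs i * reflectionAction cs j) ^ m) p =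
      ((cs.simple i * cs.simple j) ^ m * p.1 * (cs.simple j * cs.simple i) ^ m,
        p.2 + ∑ k ∈ Finset.range (2 * m),
          if p.1 = (cs.simple j * cs.simple i) ^ k * cs.simple j then 1 else 0) := by
  induction m with
  | zero => simp; rfl
  | succ m ih =>
    have hinv : ((cs.simple i * cs.simple j) ^ m)⁻¹ = (cs.simple j * cs.simple i) ^ m := by
      rw [← inv_pow]; simp
    have hsemi : cs.simple j * (cs.simple i * cs.simple j) ^ m
        = (cs.simple j * cs.simple i) ^ m * cs.simple j := by
      have h : SemiconjBy (cs.simple j) (cs.simple i * cs.simple j)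
          (cs.simple j * cs.simple i) := by simp [SemiconjBy, mul_assoc]
      exact (h.pow_right m).eq
    have hj : (cs.simple i * cs.simple j) ^ m * p.1 * (cs.simple j * cs.simple i) ^ m
          = cs.simple j ↔ p.1 = (cs.simple j * cs.simple i) ^ (2 * m) * cs.simple j := by
      rw [two_mul, pow_add, mul_assoc (_ ^ m) (_ ^ m) (cs.simple j), ← hsemi, ← hinv]
      rw [mul_inv_eq_iff_eq_mul, eq_inv_mul_iff_mul_eq]
    have hi : cs.simple j * ((cs.simple i * cs.simple j) ^ m * p.1 *
          (cs.simple j * cs.simple i) ^ m) * cs.simple j = cs.simple i ↔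
        p.1 = (cs.simple j * cs.simple i) ^ (2 * m + 1) * cs.simple j := by
      have h : (cs.simple j * cs.simple i) ^ (2 * m + 1) * cs.simple j =
          (cs.simple j * cs.simple i) ^ m * (cs.simple j * cs.simple i * cs.simple j) *
            (cs.simple i * cs.simple j) ^ m := by
        rw [two_mul, add_right_comm, pow_add, pow_succ, mul_assoc _ (_ ^ m) (cs.simple j), ← hsemi]
        simp only [mul_assoc]
      rw [h, ← hinv, ← mul_inv_eq_iff_eq_mul, eq_inv_mul_iff_mul_eq, mul_assoc,
        ← eq_inv_mul_iff_mul_eq, ← eq_mul_inv_iff_mul_eq, cs.inv_simple]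
      simp only [mul_assoc]
    rw [pow_succ']
    change reflectionAction cs i (reflectionAction cs j
      (((reflectionAction cs i * reflectionAction cs j) ^ m) p)) = _
    rw [ih]
    simp only [reflectionAction, hi, hj]
    rw [mul_add, mul_one, Finset.sum_range_succ, Finset.sum_range_succ]
    ext
    · simp only [pow_succ' (cs.simple i * cs.simple j), pow_succ (cs.simple j * cs.simple i),
        mul_assoc]
    · simp only [add_assoc]

theorem isLiftable_reflectionAction : M.IsLiftable (reflectionAction cs) := by
  classical
  intro i j
  have hone : (cs.simple j * cs.simple i) ^ M i j = 1 := cs.simple_mul_simple_pow' i j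
  funext p
  rw [reflectionAction_mul_pow_apply, two_mul, Finset.sum_range_add]
  simp only [pow_add, hone, cs.simple_mul_simple_pow, one_mul, mul_one, CharTwo.add_self_eq_zero,
    add_zero]
  rfl

open Classical in
theorem lift_reflectionAction_wordProd (ω : List B) (p : W × ZMod 2) :
    cs.lift ⟨reflectionAction cs, isLiftable_reflectionAction cs⟩ (cs.wordProd ω) p =
      (cs.wordProd ω * p.1 * (cs.wordProd ω)⁻¹, p.2 + (cs.rightInvSeq ω).count p.1) := by
  induction ω with
  | nil => simp; rfl
  | cons i ω ih =>
    rw [cs.wordProd_cons, map_mul, cs.lift_apply_simple]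
    change reflectionAction cs i
      (cs.lift ⟨reflectionAction cs, isLiftable_reflectionAction cs⟩ (cs.wordProd ω) p) = _
    rw [ih]
    have h : cs.wordProd ω * p.1 * (cs.wordProd ω)⁻¹ = cs.simple i ↔
        (cs.wordProd ω)⁻¹ * cs.simple i * cs.wordProd ω = p.1 := by
      constructor
      · intro h; rw [← h]; group
      · intro h; rw [← h]; group
    simp only [reflectionAction, h, CoxeterSystem.rightInvSeq, List.count_cons, beq_iff_eq]
    ext
    · simp [mul_assoc]
    · push_cast
      simp [add_assoc]

open Classical in
theorem count_leftInvSeq_eq_of_wordProd_eq {ω ω' : List B}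
    (h : cs.wordProd ω = cs.wordProd ω') (t : W) :
    ((cs.leftInvSeq ω).count t : ZMod 2) = (cs.leftInvSeq ω').count t := by
  have hr : cs.wordProd ω.reverse = cs.wordProd ω'.reverse := by simp [h]
  have h₁ := lift_reflectionAction_wordProd cs ω.reverse (t, 0)
  rw [hr, lift_reflectionAction_wordProd] at h₁
  simpa [cs.rightInvSeq_reverse, eq_comm] using congrArg Prod.snd h₁

/-- The exchange property, for a word that need not be reduced. -/
theorem exists_simple_mul_wordProd_eq_eraseIdx {ω : List B} {i : B}
    (h : cs.length (cs.simple i * cs.wordProd ω) < cs.length (cs.wordProd ω)) :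
    ∃ j < ω.length, cs.simple i * cs.wordProd ω = cs.wordProd (ω.eraseIdx j) := by
  classical
  obtain ⟨τ, hτ, hτ'⟩ := cs.exists_isReduced (cs.simple i * cs.wordProd ω)
  have hprod : cs.wordProd (i :: τ) = cs.wordProd ω := by
    rw [cs.wordProd_cons, ← hτ']; simp
  have hred : cs.IsReduced (i :: τ) := by
    have h₁ := cs.isLeftDescent_iff.1 (show cs.IsLeftDescent (cs.wordProd ω) i from h)
    rw [hτ', hτ.eq] at h₁
    rw [CoxeterSystem.IsReduced, hprod, ← h₁, List.length_cons]
  have hcount : (cs.leftInvSeq (i :: τ)).count (cs.simple i) = 1 :=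
    List.count_eq_one_of_mem hred.nodup_leftInvSeq (by simp [CoxeterSystem.leftInvSeq])
  have hω := count_leftInvSeq_eq_of_wordProd_eq cs hprod (cs.simple i)
  have hmem : cs.simple i ∈ cs.leftInvSeq ω := by
    by_contra hn
    rw [hcount, List.count_eq_zero_of_not_mem hn] at hω
    simp at hω
  obtain ⟨j, hj, hji⟩ := List.mem_iff_getElem.1 hmem
  refine ⟨j, by simpa using hj, ?_⟩
  rw [← cs.getD_leftInvSeq_mul_wordProd, List.getD_eq_getElem _ _ hj, hji]

/-- The exchange property for a concatenation of two words. -/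
theorem exchange_append {ω₁ ω₂ : List B} {i : B}
    (h : cs.length (cs.simple i * (cs.wordProd ω₁ * cs.wordProd ω₂)) <
      cs.length (cs.wordProd ω₁ * cs.wordProd ω₂)) :
    (∃ j < ω₁.length, cs.simple i * cs.wordProd ω₁ = cs.wordProd (ω₁.eraseIdx j)) ∨
      ∃ j < ω₂.length, cs.simple i * (cs.wordProd ω₁ * cs.wordProd ω₂) =
        cs.wordProd ω₁ * cs.wordProd (ω₂.eraseIdx j) := by
  rw [← cs.wordProd_append] at h
  obtain ⟨j, hj, he⟩ := exists_simple_mul_wordProd_eq_eraseIdx cs h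
  rcases lt_or_ge j ω₁.length with hlt | hge
  · refine Or.inl ⟨j, hlt, ?_⟩
    rw [List.eraseIdx_append_of_lt_length hlt, cs.wordProd_append, cs.wordProd_append,
      ← mul_assoc] at he
    exact mul_right_cancel he
  · refine Or.inr ⟨j - ω₁.length, by rw [List.length_append] at hj; omega, ?_⟩
    rw [List.eraseIdx_append_of_length_le hge, cs.wordProd_append, cs.wordProd_append] at he
    exact he

theorem length_wordProd_eraseIdx_lt {ω : List B} {j : ℕ} (hj : j < ω.length) :
    cs.length (cs.wordProd (ω.eraseIdx j)) < ω.length := by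
  have h := cs.length_wordProd_le (ω.eraseIdx j)
  rw [List.length_eraseIdx_of_lt hj] at h
  omega

end Exchange

section Parabolic

variable {M : CoxeterMatrix B} (cs : CoxeterSystem M W)

theorem simple_mem_parab {X : Set B} {b : B} (hb : b ∈ X) : cs.simple b ∈ parab cs X :=
  Subgroup.subset_closure ⟨b, hb, rfl⟩

theorem wordProd_mem_parab {X : Set B} {ω : List B} (hω : ∀ b ∈ ω, b ∈ X) :
    cs.wordProd ω ∈ parab cs X := by
  refine Subgroup.list_prod_mem _ fun x hx => ?_
  obtain ⟨b, hb, rfl⟩ := List.mem_map.1 hx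
  exact simple_mem_parab cs (hω b hb)

/-- Elements of a standard parabolic subgroup have reduced words in its generators. -/
theorem exists_isReduced_of_mem_parab {X : Set B} {u : W} (hu : u ∈ parab cs X) :
    ∃ ω : List B, (∀ b ∈ ω, b ∈ X) ∧ cs.IsReduced ω ∧ u = cs.wordProd ω := by
  have step : ∀ b ∈ X, ∀ y : W,
      (∃ ω : List B, (∀ b ∈ ω, b ∈ X) ∧ cs.IsReduced ω ∧ y = cs.wordProd ω) →
      ∃ ω : List B, (∀ b ∈ ω, b ∈ X) ∧ cs.IsReduced ω ∧ cs.simple b * y = cs.wordProd ω := by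
    rintro b hb _ ⟨ω, hωX, hω, rfl⟩
    rcases cs.length_simple_mul (cs.wordProd ω) b with h | h
    · refine ⟨b :: ω, by simpa [hb] using hωX, ?_, (cs.wordProd_cons b ω).symm⟩
      rw [CoxeterSystem.IsReduced, cs.wordProd_cons, h, hω.eq, List.length_cons]
    · obtain ⟨j, hj, he⟩ := exists_simple_mul_wordProd_eq_eraseIdx cs
        (show cs.length (cs.simple b * cs.wordProd ω) < cs.length (cs.wordProd ω) by omega)
      refine ⟨ω.eraseIdx j, fun c hc => hωX c (List.mem_of_mem_eraseIdx hc), ?_, he⟩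
      rw [hω.eq, he] at h
      rw [CoxeterSystem.IsReduced, List.length_eraseIdx_of_lt hj]
      omega
  induction hu using Subgroup.closure_induction_left with
  | one => exact ⟨[], by simp, by simp [CoxeterSystem.IsReduced], by simp⟩
  | mul_left x hx y hy ih =>
    obtain ⟨b, hb, rfl⟩ := hx
    exact step b hb y ih
  | inv_mul_cancel x hx y hy ih =>
    obtain ⟨b, hb, rfl⟩ := hx
    rw [cs.inv_simple]
    exact step b hb y ih

theorem length_mul_of_minimal_left {X : Set B} {v : W}
    (hv : ∀ u ∈ parab cs X, cs.length v ≤ cs.length (u * v)) {u : W} (hu : u ∈ parab cs X) :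
    cs.length (u * v) = cs.length u + cs.length v := by
  obtain ⟨ω, hωX, hω, rfl⟩ := exists_isReduced_of_mem_parab cs hu
  clear hu
  rw [hω.eq]
  induction ω with
  | nil => simp
  | cons i ω ih =>
    have hω' : cs.IsReduced ω := by simpa using hω.drop 1
    have hX : ∀ b ∈ ω, b ∈ X := fun b hb => hωX b (List.mem_cons_of_mem _ hb)
    have ih := ih hX hω'
    rw [cs.wordProd_cons, mul_assoc, List.length_cons]
    rcases cs.length_simple_mul (cs.wordProd ω * v) i with h | h
    · omega
    exfalso
    obtain ⟨τ, hτ, hvτ⟩ := cs.exists_isReduced v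
    have hlt : cs.length (cs.simple i * (cs.wordProd ω * cs.wordProd τ)) <
        cs.length (cs.wordProd ω * cs.wordProd τ) := by rw [← hvτ]; omega
    rcases exchange_append cs hlt with ⟨j, hj, he⟩ | ⟨j, hj, he⟩
    · have h₁ := length_wordProd_eraseIdx_lt cs hj
      have h₂ := hω.eq
      rw [cs.wordProd_cons, he, List.length_cons] at h₂
      omega
    · have hmem := wordProd_mem_parab cs hX
      have h₁ := hv ((cs.wordProd ω)⁻¹ * cs.simple i * cs.wordProd ω)
        (mul_mem (mul_mem (inv_mem hmem)
          (simple_mem_parab cs (hωX i List.mem_cons_self))) hmem)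
      have h₂ : (cs.wordProd ω)⁻¹ * cs.simple i * cs.wordProd ω * v =
          cs.wordProd (τ.eraseIdx j) := by
        rw [hvτ, mul_assoc, mul_assoc, he, inv_mul_cancel_left]
      have h₃ := length_wordProd_eraseIdx_lt cs hj
      rw [h₂, hvτ, hτ.eq] at h₁
      omega

theorem length_mul_of_minimal_right {X : Set B} {v : W}
    (hv : ∀ u ∈ parab cs X, cs.length v ≤ cs.length (v * u)) {u : W} (hu : u ∈ parab cs X) :
    cs.length (v * u) = cs.length v + cs.length u := by
  have h := length_mul_of_minimal_left cs (v := v⁻¹) (fun y hy => by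
    rw [← cs.length_inv (y * v⁻¹)]
    simpa using hv y⁻¹ (inv_mem hy)) (inv_mem hu)
  rw [← mul_inv_rev, cs.length_inv, cs.length_inv, cs.length_inv] at h
  omega

theorem exists_simple_of_mem_parab_of_length_eq_one {X : Set B} {u : W}
    (hu : u ∈ parab cs X) (h : cs.length u = 1) : ∃ b ∈ X, u = cs.simple b := by
  obtain ⟨ω, hωX, hω, rfl⟩ := exists_isReduced_of_mem_parab cs hu
  rw [hω.eq] at h
  obtain ⟨b, rfl⟩ := List.length_eq_one_iff.1 h
  exact ⟨b, hωX b (by simp), by simp⟩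

variable {X X' : Set B} {v : W}

/-- A left descent in `X` of `v u'`, where `v` is `(X, X')`-reduced and `u' ∈ W_{X'}`,
is conjugated by `v` into `X'`. -/
theorem exists_simple_mul_eq_mul_simple
    (hv : ∀ u ∈ parab cs X, ∀ u' ∈ parab cs X', cs.length v ≤ cs.length (u * v * u'))
    {u' : W} (hu' : u' ∈ parab cs X') {b : B} (hb : b ∈ X)
    (h : cs.length (cs.simple b * (v * u')) < cs.length (v * u')) :
    ∃ b' ∈ X', cs.simple b * v = v * cs.simple b' := by
  have hvl : ∀ u ∈ parab cs X, cs.length v ≤ cs.length (u * v) := fun u hu => by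
    simpa using hv u hu 1 (one_mem _)
  have hvr : ∀ u ∈ parab cs X', cs.length v ≤ cs.length (v * u) := fun u hu => by
    simpa using hv 1 (one_mem _) u hu
  have hsv := length_mul_of_minimal_left cs hvl (simple_mem_parab cs hb)
  rw [cs.length_simple] at hsv
  obtain ⟨τ, hτ, hvτ⟩ := cs.exists_isReduced v
  obtain ⟨ω, hωX, -, hu'ω⟩ := exists_isReduced_of_mem_parab cs hu'
  rw [hvτ, hu'ω] at h
  rcases exchange_append cs h with ⟨j, hj, he⟩ | ⟨j, hj, he⟩
  · have h₁ := length_wordProd_eraseIdx_lt cs hj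
    rw [← he, ← hτ.eq, ← hvτ] at h₁
    omega
  · rw [← hvτ, ← hu'ω] at he
    have hy : cs.wordProd (ω.eraseIdx j) * u'⁻¹ ∈ parab cs X' :=
      mul_mem (wordProd_mem_parab cs fun c hc => hωX c (List.mem_of_mem_eraseIdx hc))
        (inv_mem hu')
    have hvy : cs.simple b * v = v * (cs.wordProd (ω.eraseIdx j) * u'⁻¹) := by
      rw [← mul_assoc, ← he]; group
    have hlen := length_mul_of_minimal_right cs hvr hy
    rw [← hvy] at hlen
    obtain ⟨b', hb', hyb⟩ := exists_simple_of_mem_parab_of_length_eq_one cs hy (by omega)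
    exact ⟨b', hb', by rw [hvy, hyb]⟩

theorem mem_parab_of_mul_eq_mul
    (hv : ∀ u ∈ parab cs X, ∀ u' ∈ parab cs X', cs.length v ≤ cs.length (u * v * u'))
    {u u' : W} (hu : u ∈ parab cs X) (hu' : u' ∈ parab cs X') (h : u * v = v * u') :
    u ∈ parab cs {b : B | b ∈ X ∧
      cs.simple b ∈ (fun t => v * t * v⁻¹) '' (cs.simple '' X')} := by
  have hvl : ∀ u ∈ parab cs X, cs.length v ≤ cs.length (u * v) := fun u hu => by
    simpa using hv u hu 1 (one_mem _)
  obtain ⟨ω, hωX, hω, rfl⟩ := exists_isReduced_of_mem_parab cs hu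
  clear hu
  induction ω generalizing u' with
  | nil => simp
  | cons i ω ih =>
    have hω' : cs.IsReduced ω := by simpa using hω.drop 1
    have hX : ∀ b ∈ ω, b ∈ X := fun b hb => hωX b (List.mem_cons_of_mem _ hb)
    have hi : i ∈ X := hωX i List.mem_cons_self
    have h₁ := length_mul_of_minimal_left cs hvl (wordProd_mem_parab cs hωX)
    have h₂ := length_mul_of_minimal_left cs hvl (wordProd_mem_parab cs hX)
    have hs : cs.simple i * (v * u') = cs.wordProd ω * v := by
      rw [← h, cs.wordProd_cons]; simp [mul_assoc]
    obtain ⟨b', hb', hbv⟩ := exists_simple_mul_eq_mul_simple cs hv hu' hi (by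
      rw [hs, ← h, h₁, h₂, hω.eq, hω'.eq, List.length_cons]
      omega)
    rw [cs.wordProd_cons]
    refine mul_mem (simple_mem_parab cs ⟨hi, cs.simple b', ⟨b', hb', rfl⟩, ?_⟩)
      (ih (mul_mem (simple_mem_parab cs hb') hu') hX hω' ?_)
    · change v * cs.simple b' * v⁻¹ = cs.simple i
      rw [← hbv, mul_inv_cancel_right]
    · rw [← hs, ← mul_assoc, hbv, mul_assoc]

theorem parab_inter_conj_parab_of_reduced
    (hv : ∀ u ∈ parab cs X, ∀ u' ∈ parab cs X', cs.length v ≤ cs.length (u * v * u')) :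
    parab cs X ⊓ (parab cs X').map (MulAut.conj v).toMonoidHom =
      parab cs {b : B | b ∈ X ∧
        cs.simple b ∈ (fun t => v * t * v⁻¹) '' (cs.simple '' X')} := by
  apply le_antisymm
  · rintro u ⟨hu, u', hu', rfl⟩
    exact mem_parab_of_mul_eq_mul cs hv hu hu' (by simp)
  · refine (Subgroup.closure_le _).2 ?_
    rintro _ ⟨b, ⟨hb, t, ⟨b', hb', rfl⟩, ht⟩, rfl⟩
    exact ⟨simple_mem_parab cs hb, cs.simple b', simple_mem_parab cs hb', ht⟩

theorem map_conj_eq_self {G : Type*} [Group G] {H : Subgroup G} {g : G} (hg : g ∈ H) :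
    H.map (MulAut.conj g).toMonoidHom = H :=
  Subgroup.conj_smul_eq_self_of_mem hg

end Parabolic

/-- **Corollary 3.4.** If `w = u₀ v u₀'` with `u₀ ∈ W_X`, `u₀' ∈ W_{X'}` and `v`
`(X, X')`-reduced, then `W_X ∩ (w W_{X'} w⁻¹) = u₀ W_Y u₀⁻¹`, where `Y = (v X' v⁻¹) ∩ X`. -/
theorem parabolic_inter_conj_parabolic' {B W : Type*} [Group W]
    (M : CoxeterMatrix B) (cs : CoxeterSystem M W) (X X' : Set B) (w u₀ v u₀' : W)
    (hu₀ : u₀ ∈ parab cs X) (hu₀' : u₀' ∈ parab cs X') (hw : w = u₀ * v * u₀')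
    (hv : ∀ u ∈ parab cs X, ∀ u' ∈ parab cs X', cs.length v ≤ cs.length (u * v * u')) :
    parab cs X ⊓ (parab cs X').map (MulAut.conj w).toMonoidHom
      = (parab cs {b : B | b ∈ X ∧
          cs.simple b ∈ (fun t => v * t * v⁻¹) '' (cs.simple '' X')}).map
          (MulAut.conj u₀).toMonoidHom := by
  have hconj : (MulAut.conj w).toMonoidHom = (MulAut.conj u₀).toMonoidHom.comp
      ((MulAut.conj v).toMonoidHom.comp (MulAut.conj u₀').toMonoidHom) := by
    ext x
    simp [hw, mul_assoc]
  rw [hconj, ← Subgroup.map_map, ← Subgroup.map_map, map_conj_eq_self hu₀',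
    ← parab_inter_conj_parab_of_reduced cs hv,
    Subgroup.map_inf _ _ _ (MulAut.conj u₀).injective, map_conj_eq_self hu₀]

end CoxeterCommensurator
end

section
/- Let (W,S) be a Coxeter system with canonical representation on V, root system Φ = {w(e_s) : w ∈ W, s ∈ S}, and set of positive roots Φ^+. For α = w(e_s) ∈ Φ^+, set r_α = w s w^{-1}. Then the map Φ^+ → T, α ↦ r_α, is well-defined and is a bijection onto the set T = {wsw^{-1} : w ∈ W, s ∈ S} of reflections of (W,S). -/
open scoped Pointwise

namespace CoxeterCommensurator

variable {B W : Type*} [Group W]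

/-- The entries `B(e_i, e_j) = -cos (π / m i j)` of the bilinear form of the canonical
representation, with value `-1` when `m i j = ∞` (encoded by `m i j = 0`). -/
noncomputable def kform (M : CoxeterMatrix B) (i j : B) : ℝ :=
  if M i j = 0 then -1 else -Real.cos (Real.pi / (M i j : ℝ))

/-- The basis vector `e_i` of the space `V = B →₀ ℝ` of the canonical representation. -/
noncomputable def esimple (i : B) : B →₀ ℝ := Finsupp.single i 1

/-- `ρ` is the canonical representation of `(W, S)` on `V = B →₀ ℝ`: every simple
reflection `s i` acts by `x ↦ x - 2 B(x, e_i) e_i`. -/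
def IsCanonicalRep {M : CoxeterMatrix B} (cs : CoxeterSystem M W)
    (ρ : W →* ((B →₀ ℝ) →ₗ[ℝ] (B →₀ ℝ))) : Prop :=
  ∀ (i : B) (x : B →₀ ℝ),
    ρ (cs.simple i) x = x - (2 * x.sum fun j c => c * kform M j i) • esimple i

section CanonicalRep

variable {B W : Type*} [Group W] {M : CoxeterMatrix B} {cs : CoxeterSystem M W}
  {ρ : W →* ((B →₀ ℝ) →ₗ[ℝ] (B →₀ ℝ))}

theorem kform_self (M : CoxeterMatrix B) (i : B) : kform M i i = 1 := by
  simp [kform]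

theorem kform_comm (M : CoxeterMatrix B) (i j : B) : kform M i j = kform M j i := by
  simp only [kform, M.symmetric i j]

/-- The bilinear form of the canonical representation. -/
noncomputable def bform (M : CoxeterMatrix B) : (B →₀ ℝ) →ₗ[ℝ] (B →₀ ℝ) →ₗ[ℝ] ℝ :=
  Finsupp.linearCombination ℝ fun i => Finsupp.linearCombination ℝ fun j => kform M i j

theorem bform_esimple_esimple (M : CoxeterMatrix B) (i j : B) :
    bform M (esimple i) (esimple j) = kform M i j := by
  simp [bform, esimple]

theorem bform_comm (M : CoxeterMatrix B) (x y : B →₀ ℝ) : bform M x y = bform M y x := by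
  have h : bform M = (bform M).flip := by
    ext i j
    simpa [bform] using kform_comm M i j
  exact LinearMap.congr_fun₂ h x y

theorem bform_esimple_right (M : CoxeterMatrix B) (x : B →₀ ℝ) (i : B) :
    bform M x (esimple i) = x.sum fun j c => c * kform M j i := by
  simp [bform, esimple, Finsupp.linearCombination_apply, Finsupp.sum]

namespace IsCanonicalRep

theorem simple_apply (hρ : IsCanonicalRep cs ρ) (i : B) (x : B →₀ ℝ) :
    ρ (cs.simple i) x = x - (2 * bform M x (esimple i)) • esimple i := by
  rw [hρ, bform_esimple_right]

theorem simple_esimple_self (hρ : IsCanonicalRep cs ρ) (i : B) :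
    ρ (cs.simple i) (esimple i) = -esimple i := by
  rw [hρ.simple_apply, bform_esimple_esimple, kform_self]
  module

theorem bform_apply_apply (hρ : IsCanonicalRep cs ρ) (w : W) (x y : B →₀ ℝ) :
    bform M (ρ w x) (ρ w y) = bform M x y := by
  induction w using cs.simple_induction generalizing x y with
  | simple i =>
    simp only [hρ.simple_apply, map_sub, map_smul, LinearMap.sub_apply, LinearMap.smul_apply,
      smul_eq_mul, bform_esimple_esimple, kform_self, bform_comm M (esimple i) y]
    ring
  | one => simp
  | mul w w' hw hw' => simp [hw, hw']

theorem bform_root_self (hρ : IsCanonicalRep cs ρ) (w : W) (i : B) :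
    bform M (ρ w (esimple i)) (ρ w (esimple i)) = 1 := by
  rw [hρ.bform_apply_apply, bform_esimple_esimple, kform_self]

theorem conj_simple_apply (hρ : IsCanonicalRep cs ρ) (w : W) (i : B) (x : B →₀ ℝ) :
    ρ (w * cs.simple i * w⁻¹) x =
      x - (2 * bform M x (ρ w (esimple i))) • ρ w (esimple i) := by
  have hx : ρ w (ρ w⁻¹ x) = x := by
    rw [← Module.End.mul_apply, ← map_mul]
    simp
  have hb : bform M (ρ w⁻¹ x) (esimple i) = bform M x (ρ w (esimple i)) := by
    rw [← hρ.bform_apply_apply w, hx]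
  simp [hρ.simple_apply, hx, hb]

/-- The reflection attached to a root determines the root up to sign. -/
theorem root_eq_or_eq_neg (hρ : IsCanonicalRep cs ρ) {w w' : W} {i i' : B}
    (h : w * cs.simple i * w⁻¹ = w' * cs.simple i' * w'⁻¹) :
    ρ w (esimple i) = ρ w' (esimple i') ∨ ρ w (esimple i) = -ρ w' (esimple i') := by
  have h1 := hρ.conj_simple_apply w i (ρ w (esimple i))
  rw [h, hρ.conj_simple_apply, hρ.bform_root_self] at h1
  have hα := hρ.bform_root_self w i
  have hβ := hρ.bform_root_self w' i'
  generalize ρ w (esimple i) = α at *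
  generalize ρ w' (esimple i') = β at *
  have h2 : α = bform M α β • β := by
    have h3 : (2 : ℝ) • (α - bform M α β • β) = 0 := by
      linear_combination (norm := module) h1
    exact sub_eq_zero.1 ((smul_eq_zero.1 h3).resolve_left two_ne_zero)
  generalize bform M α β = c at h2
  have hc : c * c = 1 := by
    rw [h2] at hα
    simpa [hβ] using hα
  rcases mul_self_eq_one_iff.1 hc with rfl | rfl
  · exact Or.inl (by simpa using h2)
  · exact Or.inr (by simpa using h2)

end IsCanonicalRep

/-- The coefficients of `e_i` and `e_j` in the roots of the rank two subsystem spanned by them: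
`sin (n π / m) / sin (π / m)` for `m = m i j`, and `n` if `m = ∞`. -/
noncomputable def dihedralCoeff (M : CoxeterMatrix B) (i j : B) (n : ℕ) : ℝ :=
  if M i j = 0 then n else Real.sin (n * (Real.pi / M i j)) / Real.sin (Real.pi / M i j)

theorem dihedralCoeff_zero (M : CoxeterMatrix B) (i j : B) : dihedralCoeff M i j 0 = 0 := by
  simp [dihedralCoeff]

theorem sin_pi_div_pos {m : ℕ} (hm : 2 ≤ m) : 0 < Real.sin (Real.pi / m) := by
  have hm' : (2 : ℝ) ≤ m := by exact_mod_cast hm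
  apply Real.sin_pos_of_pos_of_lt_pi
  · have := Real.pi_pos
    positivity
  · rw [div_lt_iff₀ (by linarith)]
    nlinarith [Real.pi_pos]

theorem two_le_of_ne {i j : B} (hij : i ≠ j) (hm : M i j ≠ 0) : 2 ≤ M i j := by
  have := M.off_diagonal i j hij
  omega

theorem dihedralCoeff_one {i j : B} (hij : i ≠ j) : dihedralCoeff M i j 1 = 1 := by
  rw [dihedralCoeff]
  split_ifs with h
  · simp
  · have := sin_pi_div_pos (two_le_of_ne hij h)
    simp [this.ne']

theorem dihedralCoeff_add_two (M : CoxeterMatrix B) (i j : B) (n : ℕ) :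
    dihedralCoeff M i j (n + 2) =
      -2 * kform M i j * dihedralCoeff M i j (n + 1) - dihedralCoeff M i j n := by
  simp only [dihedralCoeff, kform]
  split_ifs with h
  · push_cast
    ring
  · generalize Real.pi / (M i j : ℝ) = θ
    have h1 : Real.sin ((n + 2 : ℕ) * θ) =
        2 * Real.cos θ * Real.sin ((n + 1 : ℕ) * θ) - Real.sin (n * θ) := by
      have e1 : ((n + 2 : ℕ) : ℝ) * θ = (n + 1 : ℕ) * θ + θ := by push_cast; ring
      have e2 : (n : ℝ) * θ = (n + 1 : ℕ) * θ - θ := by push_cast; ring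
      rw [e1, e2, Real.sin_add, Real.sin_sub]
      ring
    rw [h1]
    ring

theorem dihedralCoeff_nonneg {i j : B} (hij : i ≠ j) {n : ℕ} (hn : M i j ≠ 0 → n ≤ M i j) :
    0 ≤ dihedralCoeff M i j n := by
  rw [dihedralCoeff]
  split_ifs with h
  · positivity
  · have hm := two_le_of_ne hij h
    have hm0 : (0 : ℝ) < M i j := by exact_mod_cast (by omega : 0 < M i j)
    have hnm : (n : ℝ) ≤ M i j := by exact_mod_cast hn h
    have hpi := Real.pi_pos
    refine div_nonneg (Real.sin_nonneg_of_nonneg_of_le_pi (by positivity) ?_)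
      (sin_pi_div_pos hm).le
    rw [mul_div_assoc', div_le_iff₀ hm0]
    nlinarith

namespace IsCanonicalRep

theorem alternatingWord_esimple (hρ : IsCanonicalRep cs ρ) {i j : B} (hij : i ≠ j) (n : ℕ) :
    ρ (cs.wordProd (CoxeterSystem.alternatingWord i j n)) (esimple i) =
      dihedralCoeff M i j (n + 1) • esimple (if Even n then i else j) +
        dihedralCoeff M i j n • esimple (if Even n then j else i) := by
  induction n with
  | zero => simp [CoxeterSystem.alternatingWord, dihedralCoeff_zero, dihedralCoeff_one hij]
  | succ n ih =>
    rw [CoxeterSystem.alternatingWord_succ', cs.wordProd_cons, map_mul, Module.End.mul_apply, ih,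
      map_add, map_smul, map_smul, hρ.simple_esimple_self, hρ.simple_apply, bform_esimple_esimple,
      dihedralCoeff_add_two]
    have hk := kform_comm M i j
    by_cases hn : Even n
    · simp only [hn, Nat.even_add_one, if_true, not_true_eq_false, if_false]
      module
    · simp only [hn, Nat.even_add_one, if_true, not_false_eq_true, if_false, hk]
      module

end IsCanonicalRep

theorem isRightDescent_of_eq_mul_braidWord {i j : B} (hm : M i j ≠ 0) {w v : W}
    (hw : w = v * cs.wordProd (CoxeterSystem.alternatingWord i j (M i j)))
    (hl : cs.length v + M i j = cs.length w) : cs.IsRightDescent w i := by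
  obtain ⟨m, hm'⟩ := Nat.exists_eq_succ_of_ne_zero hm
  have hbraid := cs.wordProd_braidWord_eq i j
  rw [CoxeterSystem.braidWord, CoxeterSystem.braidWord, M.symmetric j i] at hbraid
  rw [hbraid, hm', CoxeterSystem.alternatingWord_succ, cs.wordProd_concat] at hw
  have hws : w * cs.simple i = v * cs.wordProd (CoxeterSystem.alternatingWord i j m) := by
    simp [hw, mul_assoc]
  have h1 := cs.length_mul_le v (cs.wordProd (CoxeterSystem.alternatingWord i j m))
  have h2 := cs.length_wordProd_le (CoxeterSystem.alternatingWord i j m)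
  rw [CoxeterSystem.length_alternatingWord] at h2
  rw [CoxeterSystem.IsRightDescent, hws]
  omega

/-- Every element without right descent at `i`, but with right descent at `j`, factors as a shorter
element without right descents at `i` and `j`, times a short alternating word ending in `j`. -/
theorem exists_eq_mul_alternatingWord {w : W} {i j : B} (hi : ¬cs.IsRightDescent w i)
    (hj : cs.IsRightDescent w j) :
    ∃ (v : W) (n : ℕ), w = v * cs.wordProd (CoxeterSystem.alternatingWord i j n) ∧
      cs.length v < cs.length w ∧ ¬cs.IsRightDescent v i ∧ ¬cs.IsRightDescent v j ∧
      (M i j ≠ 0 → n < M i j) := by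
  classical
  let a : ℕ → B := fun n => if Even n then j else i
  let v : ℕ → W := fun n => w * (cs.wordProd (CoxeterSystem.alternatingWord i j n))⁻¹
  have hv0 : v 0 = w := by simp [v, CoxeterSystem.alternatingWord]
  have hvs (n : ℕ) : v (n + 1) = v n * cs.simple (a n) := by
    simp [v, a, CoxeterSystem.alternatingWord_succ', cs.wordProd_cons, mul_assoc]
  have hvw (n : ℕ) : w = v n * cs.wordProd (CoxeterSystem.alternatingWord i j n) := by simp [v]
  have hex : ∃ n, cs.length (v (n + 1)) + (n + 1) ≠ cs.length w :=
    ⟨cs.length w, by omega⟩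
  obtain ⟨n, hn, hmin⟩ : ∃ n, cs.length (v (n + 1)) + (n + 1) ≠ cs.length w ∧
      ∀ k ≤ n, cs.length (v k) + k = cs.length w := by
    refine ⟨Nat.find hex, Nat.find_spec hex, fun k hk => ?_⟩
    cases k with
    | zero => simp [hv0]
    | succ k => exact not_not.1 (Nat.find_min hex hk)
  have hn0 : n ≠ 0 := by
    rintro rfl
    rw [cs.isRightDescent_iff] at hj
    apply hn
    simpa [hvs, hv0, a] using hj
  obtain ⟨k, rfl⟩ := Nat.exists_eq_succ_of_ne_zero hn0
  have hk := hmin k (by omega)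
  have hk1 := hmin (k + 1) le_rfl
  have hnew : ¬cs.IsRightDescent (v (k + 1)) (a (k + 1)) := by
    intro h
    rw [cs.isRightDescent_iff, ← hvs] at h
    apply hn
    simp only [Nat.succ_eq_add_one]
    omega
  have hold : ¬cs.IsRightDescent (v (k + 1)) (a k) := by
    rw [CoxeterSystem.IsRightDescent, hvs, mul_assoc, cs.simple_mul_simple_self, mul_one, ← hvs]
    omega
  refine ⟨v (k + 1), k + 1, hvw _, by omega, ?_, ?_, fun hm => ?_⟩
  · by_cases he : Even k
    · simpa [a, he, Nat.even_add_one] using hnew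
    · simpa [a, he] using hold
  · by_cases he : Even k
    · simpa [a, he] using hold
    · simpa [a, he, Nat.even_add_one] using hnew
  · by_contra hlt
    exact hi (isRightDescent_of_eq_mul_braidWord hm (hvw _) (hmin _ (by omega)))

namespace IsCanonicalRep

theorem root_nonneg (hρ : IsCanonicalRep cs ρ) {w : W} {i : B} (hi : ¬cs.IsRightDescent w i)
    (b : B) : 0 ≤ ρ w (esimple i) b := by
  induction hl : cs.length w using Nat.strong_induction_on generalizing w i with
  | h l ih =>
    subst hl
    by_cases hw : w = 1
    · subst hw
      simp only [map_one, Module.End.one_apply, esimple]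
      exact Finsupp.single_nonneg.2 zero_le_one b
    obtain ⟨j, hj⟩ := cs.exists_rightDescent_of_ne_one hw
    have hij : i ≠ j := by
      rintro rfl
      exact hi hj
    obtain ⟨v, n, hv, hlen, hvi, hvj, hn⟩ := exists_eq_mul_alternatingWord hi hj
    have hpi := ih _ hlen hvi rfl
    have hpj := ih _ hlen hvj rfl
    have h1 : 0 ≤ dihedralCoeff M i j (n + 1) := dihedralCoeff_nonneg hij hn
    have h0 : 0 ≤ dihedralCoeff M i j n := dihedralCoeff_nonneg hij fun hm => (hn hm).le
    rw [hv, map_mul, Module.End.mul_apply, hρ.alternatingWord_esimple hij, map_add, map_smul,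
      map_smul, Finsupp.add_apply, Finsupp.smul_apply, Finsupp.smul_apply, smul_eq_mul, smul_eq_mul]
    split_ifs <;> positivity

theorem mul_simple_esimple (hρ : IsCanonicalRep cs ρ) (w : W) (i : B) :
    ρ (w * cs.simple i) (esimple i) = -ρ w (esimple i) := by
  rw [map_mul, Module.End.mul_apply, hρ.simple_esimple_self, map_neg]

theorem root_ne_zero (hρ : IsCanonicalRep cs ρ) (w : W) (i : B) : ρ w (esimple i) ≠ 0 := by
  intro h
  simpa [h] using hρ.bform_root_self w i

theorem root_nonpos (hρ : IsCanonicalRep cs ρ) {w : W} {i : B} (hi : cs.IsRightDescent w i)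
    (b : B) : ρ w (esimple i) b ≤ 0 := by
  have := hρ.root_nonneg (cs.isRightDescent_iff_not_isRightDescent_mul.1 hi) b
  rw [hρ.mul_simple_esimple, Finsupp.neg_apply] at this
  linarith

theorem injective (hρ : IsCanonicalRep cs ρ) : Function.Injective ρ := by
  rw [injective_iff_map_eq_one]
  intro w hw
  by_contra hne
  obtain ⟨i, hi⟩ := cs.exists_rightDescent_of_ne_one hne
  have := hρ.root_nonpos hi i
  simp only [hw, Module.End.one_apply, esimple, Finsupp.single_eq_same] at this
  linarith

theorem conj_simple_eq (hρ : IsCanonicalRep cs ρ) {w w' : W} {i i' : B}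
    (h : ρ w (esimple i) = ρ w' (esimple i')) :
    w * cs.simple i * w⁻¹ = w' * cs.simple i' * w'⁻¹ := by
  apply hρ.injective
  ext1 x
  ext1
  simp only [LinearMap.comp_apply, hρ.conj_simple_apply, h]

end IsCanonicalRep

end CanonicalRep

/-- **Proposition 3.5 (Deodhar).** The map `Φ⁺ → T`, `α = w(e_s) ↦ r_α = w s w⁻¹`, is
well-defined and bijective, where `Φ⁺` is the set of positive roots and `T` is the set of
reflections of `(W, S)`. -/
theorem positive_roots_equiv_reflections {B W : Type*} [Group W]
    (M : CoxeterMatrix B) (cs : CoxeterSystem M W)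
    (ρ : W →* ((B →₀ ℝ) →ₗ[ℝ] (B →₀ ℝ))) (hρ : IsCanonicalRep cs ρ) :
    ∃ f : {α : B →₀ ℝ // (∃ (w : W) (i : B), ρ w (esimple i) = α) ∧ ∀ j, 0 ≤ α j}
        → {t : W // cs.IsReflection t},
      Function.Bijective f ∧
      ∀ (w : W) (i : B)
        (h : (∃ (w' : W) (i' : B), ρ w' (esimple i') = ρ w (esimple i)) ∧
          ∀ j, 0 ≤ (ρ w (esimple i)) j),
        (f ⟨ρ w (esimple i), h⟩ : W) = w * cs.simple i * w⁻¹ := by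
  let f : {α : B →₀ ℝ // (∃ (w : W) (i : B), ρ w (esimple i) = α) ∧ ∀ j, 0 ≤ α j}
      → {t : W // cs.IsReflection t} := fun α =>
    ⟨α.2.1.choose * cs.simple α.2.1.choose_spec.choose * α.2.1.choose⁻¹, _, _, rfl⟩
  have hf : ∀ (w : W) (i : B)
      (h : (∃ (w' : W) (i' : B), ρ w' (esimple i') = ρ w (esimple i)) ∧
        ∀ j, 0 ≤ (ρ w (esimple i)) j),
      (f ⟨ρ w (esimple i), h⟩ : W) = w * cs.simple i * w⁻¹ :=
    fun w i h => hρ.conj_simple_eq h.1.choose_spec.choose_spec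
  refine ⟨f, ⟨?_, ?_⟩, hf⟩
  · rintro ⟨_, ⟨w, i, rfl⟩, hα⟩ ⟨_, ⟨w', i', rfl⟩, hβ⟩ h
    have h' := congrArg Subtype.val h
    rw [hf, hf] at h'
    rw [Subtype.mk.injEq]
    refine (hρ.root_eq_or_eq_neg h').resolve_right fun hneg => hρ.root_ne_zero w i ?_
    ext j
    have h1 := hα j
    have h2 := hβ j
    rw [hneg, Finsupp.neg_apply] at h1
    rw [hneg, Finsupp.neg_apply, Finsupp.zero_apply]
    linarith
  · rintro ⟨_, w, i, rfl⟩
    by_cases hi : cs.IsRightDescent w i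
    · have hpos := hρ.root_nonneg (cs.isRightDescent_iff_not_isRightDescent_mul.1 hi)
      refine ⟨⟨_, ⟨w * cs.simple i, i, rfl⟩, hpos⟩, Subtype.ext ?_⟩
      rw [hf]
      simp [mul_assoc]
    · exact ⟨⟨_, ⟨w, i, rfl⟩, hρ.root_nonneg hi⟩, Subtype.ext (hf _ _ _)⟩

end CoxeterCommensurator
end
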